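/- In the universal enveloping algebra of sl₂, for all nonnegative integers m and n, the Cartier–Kostant commutation formula holds: (eᵐ/m!)·(fⁿ/n!) = Σ_{k=0}^{min(m,n)} (f^{n−k}/(n−k)!) · C(h − n − m + 2k, k) · (e^{m−k}/(m−k)!), where C(u, k) = u(u−1)⋯(u−k+1)/k!. -/

import Mathlib

/-- The divided power `xᵐ/m!` in a `ℚ`-algebra. -/
noncomputable def dividedPower {A : Type*} [Ring A] [Algebra ℚ A] (m : ℕ) (x : A) : A :=
  (1 / (m.factorial : ℚ)) • x ^ m

/-- The binomial coefficient polynomial `C(u, k) = u(u−1)⋯(u−k+1)/k!` evaluated at an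
element `u` of a `ℚ`-algebra. -/
noncomputable def binomElt {A : Type*} [Ring A] [Algebra ℚ A] (u : A) (k : ℕ) : A :=
  (1 / (k.factorial : ℚ)) • ((List.range k).map fun j : ℕ => u - (j : A)).prod

/-- The falling product `u(u−1)⋯(u−k+1)` in a ring. -/
def fallingProd {A : Type*} [Ring A] (u : A) (k : ℕ) : A :=
  ((List.range k).map fun j : ℕ => u - (j : A)).prod

section FallingProd

variable {A : Type*} [Ring A]

@[simp]
theorem fallingProd_zero (u : A) : fallingProd u 0 = 1 := by
  simp [fallingProd]

theorem fallingProd_succ (u : A) (k : ℕ) :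
    fallingProd u (k + 1) = fallingProd u k * (u - k) := by
  simp [fallingProd, List.range_succ]

theorem fallingProd_add_one_succ (u : A) (k : ℕ) :
    fallingProd (u + 1) (k + 1) = (u + 1) * fallingProd u k := by
  induction k with
  | zero => simp [fallingProd_succ]
  | succ k ih =>
    rw [fallingProd_succ, ih, fallingProd_succ u k, mul_assoc]
    push_cast
    rw [add_sub_add_right_eq_sub]

theorem commute_fallingProd (u : A) (k : ℕ) : Commute u (fallingProd u k) := by
  induction k with
  | zero => simp
  | succ k ih =>
    rw [fallingProd_succ]
    exact ih.mul_right ((Commute.refl u).sub_right (Nat.cast_commute k u).symm)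

theorem semiconjBy_fallingProd {x u v : A} (hx : SemiconjBy x u v) (k : ℕ) :
    SemiconjBy x (fallingProd u k) (fallingProd v k) := by
  induction k with
  | zero => simp
  | succ k ih =>
    rw [fallingProd_succ, fallingProd_succ]
    exact ih.mul_right (hx.sub_right (Nat.cast_commute k x).symm)

theorem choose_smul_fallingProd_add_one [Algebra ℚ A] (u : A) (m k : ℕ) :
    ((m + 1).choose (k + 1) : ℚ) • fallingProd (u + 1) (k + 1)
      = (m.choose (k + 1) : ℚ) • fallingProd u (k + 1)
        + (m.choose k : ℚ) • ((u + (m : A) + 1 - (k : A)) * fallingProd u k) := by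
  have hchoose : (m.choose (k + 1) : ℚ) * (k + 1) = m.choose k * (m - k) := by
    rcases le_or_gt k m with hk | hk
    · rw [← Nat.cast_sub hk]
      exact_mod_cast Nat.choose_succ_right_eq m k
    · simp [Nat.choose_eq_zero_of_lt hk, Nat.choose_eq_zero_of_lt (Nat.lt_succ_of_lt hk)]
  have cast_mul (j : ℕ) (x : A) : (j : A) * x = (j : ℚ) • x := by
    rw [Nat.cast_smul_eq_nsmul, nsmul_eq_mul]
  rw [fallingProd_add_one_succ, fallingProd_succ, mul_sub, ← (commute_fallingProd u k).eq,
    ← (Nat.cast_commute k (fallingProd u k)).eq, Nat.choose_succ_succ]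
  simp only [add_mul, sub_mul, one_mul, cast_mul, Nat.cast_add]
  linear_combination (norm := module) hchoose • fallingProd u k

end FallingProd

section SlTwo

variable {A : Type*} [Ring A] {e f h : A}

theorem h_mul_f_pow (hhf : h * f - f * h = -2 * f) (n : ℕ) :
    h * f ^ n = f ^ n * (h - 2 * (n : A)) := by
  induction n with
  | zero => simp
  | succ n ih =>
    have hf : h * f = f * (h - 2) := by
      rw [sub_eq_iff_eq_add] at hhf
      rw [hhf]
      noncomm_ring
    have hn : (h - 2 * (n : A)) * f = f * (h - 2 * ((n + 1 : ℕ) : A)) := by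
      have hc : (2 * (n : A)) * f = f * (2 * (n : A)) := by
        exact_mod_cast (Nat.cast_commute (2 * n) f).eq
      rw [sub_mul, hc, hf]
      push_cast
      noncomm_ring
    rw [pow_succ, ← mul_assoc, ih, mul_assoc, hn, mul_assoc]

theorem e_mul_f_pow (hef : e * f - f * e = h) (hhf : h * f - f * h = -2 * f) (n : ℕ) :
    e * f ^ (n + 1) = f ^ (n + 1) * e + ((n : A) + 1) * (f ^ n * (h - (n : A))) := by
  induction n with
  | zero => simp [← hef]
  | succ n ih =>
    have hef' : e * f = f * e + h := by rw [← hef]; abel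
    have hn : (n : A) * f = f * n := (Nat.cast_commute n f).eq
    have hfn := h_mul_f_pow hhf (n + 1)
    rw [pow_succ' f (n + 1), ← mul_assoc, hef', add_mul, mul_assoc, ih, hfn]
    have hc : f * (((n : A) + 1) * (f ^ n * (h - (n : A))))
        = ((n : A) + 1) * (f ^ (n + 1) * (h - (n : A))) := by
      rw [← mul_assoc, mul_add, ← hn, mul_one, ← add_one_mul, pow_succ', mul_assoc, mul_assoc]
    have hp : (n : A) * f ^ (n + 1) = f ^ (n + 1) * n := (Nat.cast_commute n _).eq
    rw [mul_add, hc]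
    push_cast
    simp only [add_mul, one_mul, ← mul_assoc, hp]
    noncomm_ring

/-- The commutation formula for ordinary powers. -/
theorem e_pow_mul_f_pow [Algebra ℚ A] (hef : e * f - f * e = h) (hhe : h * e - e * h = 2 * e)
    (hhf : h * f - f * h = -2 * f) (m n : ℕ) :
    e ^ m * f ^ n = ∑ k ∈ Finset.range (m + 1), ((m.choose k * n.descFactorial k : ℕ) : ℚ) •
      (f ^ (n - k) * fallingProd (h - (n : A) - (m : A) + 2 * (k : A)) k * e ^ (m - k)) := by
  induction m with
  | zero => simp
  | succ m ih =>
    let u : ℕ → A := fun k => h - (n : A) - (m : A) + 2 * (k : A)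
    let a : ℕ → A := fun k => ((m.choose k * n.descFactorial k : ℕ) : ℚ) •
      (f ^ (n - k) * fallingProd (u k - 2) k * e ^ (m + 1 - k))
    let b : ℕ → A := fun k => ((m.choose k * n.descFactorial (k + 1) : ℕ) : ℚ) •
      (f ^ (n - (k + 1)) * ((h - (n : A) + (k : A) + 1) * fallingProd (u k) k) * e ^ (m - k))
    have term (k : ℕ) (hk : k ∈ Finset.range (m + 1)) :
        e * (((m.choose k * n.descFactorial k : ℕ) : ℚ) •
          (f ^ (n - k) * fallingProd (u k) k * e ^ (m - k))) = a k + b k := by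
      have hkm : m + 1 - k = m - k + 1 := by
        have := Finset.mem_range.mp hk
        omega
      have hsemi : SemiconjBy e (u k) (u k - 2) := by
        have h1 : SemiconjBy e h (h - 2) := by
          rw [SemiconjBy, sub_mul, ← hhe]
          abel
        have h2 := ((h1.sub_right (Nat.cast_commute n e).symm).sub_right
          (Nat.cast_commute m e).symm).add_right (Nat.cast_commute (2 * k) e).symm
        have h3 : u k - 2 = h - 2 - (n : A) - (m : A) + ((2 * k : ℕ) : A) := by
          simp only [u]
          push_cast
          abel
        rw [h3]
        simpa [u] using h2
      have hP := (semiconjBy_fallingProd hsemi k).eq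
      have hE : e * e ^ (m - k) = e ^ (m + 1 - k) := by rw [hkm, pow_succ']
      rcases lt_trichotomy k n with hkn | rfl | hkn
      · obtain ⟨j, rfl⟩ : ∃ j, n = k + (j + 1) := ⟨n - k - 1, by omega⟩
        have hj : k + (j + 1) - k = j + 1 := by omega
        have hj' : k + (j + 1) - (k + 1) = j := by omega
        have hh : h - ((k + (j + 1) : ℕ) : A) + (k : A) + 1 = h - (j : A) := by
          push_cast
          abel
        have hd : ((m.choose k * (k + (j + 1)).descFactorial (k + 1) : ℕ) : ℚ)
            = ((m.choose k * (k + (j + 1)).descFactorial k : ℕ) : ℚ) * ((j + 1 : ℕ) : ℚ) := by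
          rw [Nat.descFactorial_succ, hj]
          push_cast
          ring
        simp only [a, b, hj, hj', hh, hd, mul_smul]
        rw [← smul_add, mul_smul_comm, ← hE]
        congr 1
        rw [Nat.cast_smul_eq_nsmul, nsmul_eq_mul, ← mul_assoc, ← mul_assoc, e_mul_f_pow hef hhf,
          add_mul, add_mul, mul_assoc _ e, hP]
        push_cast
        simp only [mul_assoc]
      · simp only [a, b, Nat.sub_self, pow_zero, one_mul, Nat.descFactorial_succ, mul_zero,
          zero_mul, Nat.cast_zero, zero_smul, add_zero]
        rw [mul_smul_comm, ← mul_assoc, hP, mul_assoc, hE]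
      · simp [a, b, Nat.descFactorial_eq_zero_iff_lt.mpr hkn]
    have ha : a (m + 1) = 0 := by simp [a]
    rw [pow_succ', mul_assoc, ih, Finset.mul_sum, Finset.sum_congr rfl term,
      Finset.sum_add_distrib, ← add_zero (∑ k ∈ Finset.range (m + 1), a k), ← ha,
      ← Finset.sum_range_succ, Finset.sum_range_succ' a, Finset.sum_range_succ' _ (m + 1),
      add_right_comm, ← Finset.sum_add_distrib]
    congr 1
    · refine Finset.sum_congr rfl fun k _ => ?_
      have hu : h - (n : A) - ((m + 1 : ℕ) : A) + 2 * ((k + 1 : ℕ) : A) = u k + 1 := by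
        simp only [u]
        push_cast
        noncomm_ring
      have hu' : u (k + 1) - 2 = u k := by
        simp only [u]
        push_cast
        rw [mul_add, mul_one, ← add_assoc, add_sub_cancel_right]
      have hu'' : h - (n : A) + (k : A) + 1 = u k + (m : A) + 1 - (k : A) := by
        simp only [u]
        noncomm_ring
      have hk : m + 1 - (k + 1) = m - k := by omega
      simp only [a, b, hu, hu', hu'', hk]
      have key := congrArg (fun x => (n.descFactorial (k + 1) : ℚ) •
        (f ^ (n - (k + 1)) * x * e ^ (m - k))) (choose_smul_fallingProd_add_one (u k) m k)
      simp only [mul_add, add_mul, mul_smul_comm, smul_mul_assoc, smul_add, smul_smul] at key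
      push_cast
      simp only [mul_comm _ (n.descFactorial (k + 1) : ℚ)]
      rw [key]
    · simp [a]

end SlTwo

/-- The Cartier–Kostant commutation formula in the universal enveloping algebra of `sl₂`
(or any associative `ℚ`-algebra) with Chevalley generators `e, f, h`:
`(eᵐ/m!)·(fⁿ/n!) = Σ_{k=0}^{min(m,n)} (f^{n−k}/(n−k)!)·C(h−n−m+2k, k)·(e^{m−k}/(m−k)!)`. -/
theorem cartier_kostant_formula {A : Type*} [Ring A] [Algebra ℚ A] (e f h : A)
    (hef : e * f - f * e = h) (hhe : h * e - e * h = 2 * e) (hhf : h * f - f * h = -2 * f)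
    (m n : ℕ) :
    dividedPower m e * dividedPower n f
      = ∑ k ∈ Finset.range (min m n + 1),
          dividedPower (n - k) f
            * binomElt (h - (n : A) - (m : A) + 2 * (k : A)) k
            * dividedPower (m - k) e := by
  have hsub : Finset.range (min m n + 1) ⊆ Finset.range (m + 1) :=
    Finset.range_subset_range.mpr (by omega)
  simp only [dividedPower, smul_mul_assoc, mul_smul_comm, smul_smul]
  rw [e_pow_mul_f_pow hef hhe hhf, ← Finset.sum_subset hsub, Finset.smul_sum]
  · refine Finset.sum_congr rfl fun k hk => ?_
    have hkmn := Finset.mem_range.mp hk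
    have hkm : k ≤ m := by omega
    have hkn : k ≤ n := by omega
    rw [binomElt, ← fallingProd, smul_smul, mul_smul_comm, smul_mul_assoc, smul_smul]
    congr 1
    have hm := Nat.choose_mul_factorial_mul_factorial hkm
    have hn := Nat.factorial_mul_descFactorial hkn
    rw [← hm, ← hn]
    have hc : (m.choose k : ℚ) ≠ 0 := by exact_mod_cast (Nat.choose_pos hkm).ne'
    have hd : (n.descFactorial k : ℚ) ≠ 0 := by
      exact_mod_cast (Nat.descFactorial_pos.mpr hkn).ne'
    push_cast
    field_simp
  · intro k hk hk'
    have hnk : n < k := by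
      simp only [Finset.mem_range] at hk hk'
      omega
    simp [Nat.descFactorial_eq_zero_iff_lt.mpr hnk]
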